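/- arXiv:1712.09928 — 3 statements merged into one kernel-verified Lean document; each statement's English description precedes it below -/
import Mathlib

section
/- Fix an integer k ≥ 1. Let φ and ψ be 2×2 matrices over the polynomial ring ℂ[X] with trace zero, and suppose the constant term of φ (the matrix of constant coefficients of its entries) is nonzero. Then the following are equivalent: (a) for every 2×2 trace-zero matrix ψ₂ over ℂ[X] all of whose entries have degree < k, the coefficient of X^{k−1} in tr(ψ(φψ₂ − ψ₂φ)) vanishes; (b) there exists f ∈ ℂ[X] such that every entry of ψ − fφ is divisible by X^k. -/
open Polynomial

/-- If the degree `k - 1` coefficient of `g * p` vanishes for every `p` of degree `< k`, then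
`X ^ k` divides `g`. -/
theorem X_pow_dvd_of_coeff_mul_eq_zero {R : Type*} [CommRing R] {k : ℕ} {g : R[X]}
    (h : ∀ p ∈ degreeLT R k, (g * p).coeff (k - 1) = 0) : X ^ k ∣ g := by
  rw [X_pow_dvd_iff]
  intro m hm
  have hX : (X ^ (k - 1 - m) : R[X]) ∈ degreeLT R k :=
    mem_degreeLT.2 ((degree_X_pow_le _).trans_lt (by exact_mod_cast (by omega : k - 1 - m < k)))
  have := h _ hX
  rwa [show k - 1 = m + (k - 1 - m) by omega, show m + (k - 1 - m) - m = k - 1 - m by omega,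
    coeff_mul_X_pow] at this

/-- A polynomial over a field with nonzero constant term is invertible modulo `X ^ k`. -/
theorem exists_X_pow_dvd_mul_sub_one {K : Type*} [Field K] {a : K[X]} (ha : a.coeff 0 ≠ 0)
    (k : ℕ) : ∃ u : K[X], X ^ k ∣ u * a - 1 := by
  have hX : ¬ (X : K[X]) ∣ a := by rwa [X_dvd_iff]
  obtain ⟨v, u, huv⟩ := ((prime_X.irreducible.coprime_iff_not_dvd).2 hX).pow_left (m := k)
  exact ⟨u, -v, by linear_combination huv⟩

/-- If `a` is invertible modulo `d` and the minors `p * b - q * a`, `r * a - p * c` vanish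
modulo `d`, then `(p, q, r)` is a multiple of `(a, b, c)` modulo `d`. -/
theorem exists_dvd_sub_mul_of_dvd_minors {R : Type*} [CommRing R] {d a b c p q r u : R}
    (hu : d ∣ u * a - 1) (hq : d ∣ p * b - q * a) (hr : d ∣ r * a - p * c) :
    ∃ f : R, d ∣ p - f * a ∧ d ∣ q - f * b ∧ d ∣ r - f * c := by
  obtain ⟨s, hs⟩ := hu
  obtain ⟨t, ht⟩ := hq
  obtain ⟨w, hw⟩ := hr
  exact ⟨p * u, ⟨-p * s, by linear_combination -p * hs⟩,
    ⟨-q * s - u * t, by linear_combination -q * hs - u * ht⟩,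
    ⟨-r * s + u * w, by linear_combination -r * hs + u * hw⟩⟩

/-- The pairing `tr (ψ [φ, χ])` of trace-zero 2×2 matrices in coordinates. -/
theorem trace_mul_commutator_fin_two {R : Type*} [CommRing R] {φ ψ χ : Matrix (Fin 2) (Fin 2) R}
    (hφ : φ 1 1 = -φ 0 0) (hψ : ψ 1 1 = -ψ 0 0) (hχ : χ 1 1 = -χ 0 0) :
    (ψ * (φ * χ - χ * φ)).trace =
      2 * ((ψ 0 1 * φ 1 0 - ψ 1 0 * φ 0 1) * χ 0 0 + (ψ 0 0 * φ 0 1 - ψ 0 1 * φ 0 0) * χ 1 0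
        + (ψ 1 0 * φ 0 0 - ψ 0 0 * φ 1 0) * χ 0 1) := by
  simp only [Matrix.trace_fin_two, Matrix.mul_apply, Fin.sum_univ_two, Matrix.sub_apply, hφ, hψ, hχ]
  ring

/-- Radical of the residue pairing of order `k`:  for trace-zero 2×2 matrix polynomials
`φ`, `ψ` with `φ(0) ≠ 0`, the coefficient of `X^(k-1)` in `tr(ψ[φ,ψ₂])` vanishes for every
trace-zero `ψ₂` of degree `< k` if and only if `ψ` agrees with a `ℂ[X]`-multiple of `φ`
modulo `X^k`. -/
theorem residue_pairing_radical (k : ℕ) (hk : 1 ≤ k)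
    (φ ψ : Matrix (Fin 2) (Fin 2) (Polynomial ℂ))
    (hφtr : φ.trace = 0) (hψtr : ψ.trace = 0)
    (hφ0 : (Matrix.of fun i j => (φ i j).coeff 0) ≠ (0 : Matrix (Fin 2) (Fin 2) ℂ)) :
    (∀ ψ₂ : Matrix (Fin 2) (Fin 2) (Polynomial ℂ), ψ₂.trace = 0 →
        (∀ i j, ψ₂ i j ∈ Polynomial.degreeLT ℂ k) →
        ((ψ * (φ * ψ₂ - ψ₂ * φ)).trace).coeff (k - 1) = 0) ↔
      ∃ f : Polynomial ℂ, ∀ i j, (X : Polynomial ℂ) ^ k ∣ (ψ - f • φ) i j := by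
  have apply_one_one {χ : Matrix (Fin 2) (Fin 2) ℂ[X]} (h : χ.trace = 0) : χ 1 1 = -χ 0 0 := by
    rw [Matrix.trace_fin_two] at h
    linear_combination h
  have hφ := apply_one_one hφtr
  have hψ := apply_one_one hψtr
  constructor
  · intro h
    have pairing (x y z : ℂ[X]) (hx : x ∈ degreeLT ℂ k) (hy : y ∈ degreeLT ℂ k)
        (hz : z ∈ degreeLT ℂ k) :
        ((ψ 0 1 * φ 1 0 - ψ 1 0 * φ 0 1) * x + (ψ 0 0 * φ 0 1 - ψ 0 1 * φ 0 0) * z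
          + (ψ 1 0 * φ 0 0 - ψ 0 0 * φ 1 0) * y).coeff (k - 1) = 0 := by
      have key := h !![x, y; z, -x] (by simp [Matrix.trace_fin_two]) (by
        intro i j
        fin_cases i <;> fin_cases j
        exacts [hx, hy, hz, neg_mem hx])
      rw [trace_mul_commutator_fin_two hφ hψ (by simp), coeff_ofNat_mul] at key
      simpa using key
    have h₁ : X ^ k ∣ ψ 0 1 * φ 1 0 - ψ 1 0 * φ 0 1 := X_pow_dvd_of_coeff_mul_eq_zero
      fun p hp => by simpa using pairing p 0 0 hp (zero_mem _) (zero_mem _)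
    have h₂ : X ^ k ∣ ψ 0 0 * φ 0 1 - ψ 0 1 * φ 0 0 := X_pow_dvd_of_coeff_mul_eq_zero
      fun p hp => by simpa using pairing 0 0 p (zero_mem _) (zero_mem _) hp
    have h₃ : X ^ k ∣ ψ 1 0 * φ 0 0 - ψ 0 0 * φ 1 0 := X_pow_dvd_of_coeff_mul_eq_zero
      fun p hp => by simpa using pairing 0 p 0 (zero_mem _) hp (zero_mem _)
    obtain ⟨f, h00, h01, h10⟩ : ∃ f : ℂ[X], X ^ k ∣ ψ 0 0 - f * φ 0 0 ∧
        X ^ k ∣ ψ 0 1 - f * φ 0 1 ∧ X ^ k ∣ ψ 1 0 - f * φ 1 0 := by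
      by_cases ha : (φ 0 0).coeff 0 = 0
      · by_cases hb : (φ 0 1).coeff 0 = 0
        · have hc : (φ 1 0).coeff 0 ≠ 0 := by
            contrapose! hφ0
            ext i j
            fin_cases i <;> fin_cases j <;> simp [ha, hb, hφ0, hφ]
          obtain ⟨u, hu⟩ := exists_X_pow_dvd_mul_sub_one hc k
          obtain ⟨f, h10, h00, h01⟩ := exists_dvd_sub_mul_of_dvd_minors hu h₃ h₁
          exact ⟨f, h00, h01, h10⟩
        · obtain ⟨u, hu⟩ := exists_X_pow_dvd_mul_sub_one hb k
          obtain ⟨f, h01, h10, h00⟩ := exists_dvd_sub_mul_of_dvd_minors hu h₁ h₂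
          exact ⟨f, h00, h01, h10⟩
      · obtain ⟨u, hu⟩ := exists_X_pow_dvd_mul_sub_one ha k
        exact exists_dvd_sub_mul_of_dvd_minors hu h₂ h₃
    refine ⟨f, fun i j => ?_⟩
    rw [Matrix.sub_apply, Matrix.smul_apply, smul_eq_mul]
    fin_cases i <;> fin_cases j
    · exact h00
    · exact h01
    · exact h10
    · change X ^ k ∣ ψ 1 1 - f * φ 1 1
      rw [hφ, hψ, show -ψ 0 0 - f * -φ 0 0 = -(ψ 0 0 - f * φ 0 0) by ring]
      exact h00.neg_right
  · rintro ⟨f, hf⟩ χ hχtr -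
    simp only [Matrix.sub_apply, Matrix.smul_apply, smul_eq_mul] at hf
    obtain ⟨s, hs⟩ := hf 0 0
    obtain ⟨t, ht⟩ := hf 0 1
    obtain ⟨w, hw⟩ := hf 1 0
    have hdvd : X ^ k ∣ (ψ * (φ * χ - χ * φ)).trace := by
      rw [trace_mul_commutator_fin_two hφ hψ (apply_one_one hχtr)]
      refine ⟨2 * ((t * φ 1 0 - w * φ 0 1) * χ 0 0 + (s * φ 0 1 - t * φ 0 0) * χ 1 0
        + (w * φ 0 0 - s * φ 1 0) * χ 0 1), ?_⟩
      linear_combination 2 * (φ 0 1 * χ 1 0 - φ 1 0 * χ 0 1) * hs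
        + 2 * (φ 1 0 * χ 0 0 - φ 0 0 * χ 1 0) * ht + 2 * (φ 0 0 * χ 0 1 - φ 0 1 * χ 0 0) * hw
    exact X_pow_dvd_iff.1 hdvd _ (by omega)
end

section
/- Let V and W be real vector spaces. Suppose I_V, J_V are linear endomorphisms of V with I_V² = −id and J_V² = −id, and I_W, J_W are linear endomorphisms of W with I_W² = −id, J_W² = −id, and I_W J_W = −J_W I_W. Let S : V × V → W be a symmetric ℝ-bilinear map satisfying S(I_V x, y) = I_W S(x,y) and S(J_V x, y) = J_W S(x,y) for all x, y ∈ V. Then S = 0. -/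
/-- If `S` is a symmetric bilinear map between real vector spaces that is complex-linear
for two complex structures `I`, `J` that anticommute on the target, then `S = 0`.
(This is why a hyperkähler submanifold is totally geodesic: its second fundamental form
vanishes.) -/
theorem symm_bilinear_two_complex_structures_eq_zero
    {V W : Type*} [AddCommGroup V] [Module ℝ V] [AddCommGroup W] [Module ℝ W]
    (IV JV : V →ₗ[ℝ] V) (IW JW : W →ₗ[ℝ] W)
    (hIV : IV ∘ₗ IV = -LinearMap.id) (hJV : JV ∘ₗ JV = -LinearMap.id)
    (hIW : IW ∘ₗ IW = -LinearMap.id) (hJW : JW ∘ₗ JW = -LinearMap.id)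
    (hanti : IW ∘ₗ JW = -(JW ∘ₗ IW))
    (S : V →ₗ[ℝ] V →ₗ[ℝ] W)
    (hsymm : ∀ x y : V, S x y = S y x)
    (hI : ∀ x y : V, S (IV x) y = IW (S x y))
    (hJ : ∀ x y : V, S (JV x) y = JW (S x y)) :
    S = 0 := by
  ext x y
  have hcomm : IW (JW (S x y)) = JW (IW (S x y)) := by
    rw [← hI x y, hsymm (IV x) y, ← hJ y (IV x), hsymm (JV y) (IV x), hI x (JV y),
      hsymm x (JV y), hJ y x, hsymm y x]
  have hneg : IW (JW (S x y)) = -JW (IW (S x y)) := LinearMap.congr_fun hanti (S x y)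
  have htors : IsAddTorsionFree W := .of_isTorsionFree ℝ W
  have hzero : JW (IW (S x y)) = 0 := self_eq_neg.mp (hcomm.symm.trans hneg)
  have hJJ : JW (JW (IW (S x y))) = -IW (S x y) := LinearMap.congr_fun hJW (IW (S x y))
  have hII : IW (IW (S x y)) = -S x y := LinearMap.congr_fun hIW (S x y)
  have hIS : IW (S x y) = 0 := by simpa [hzero] using hJJ
  simpa [hIS] using hII
end

section
/- Let s, t ∈ ℂ with s ≠ 0, s ≠ 1, t ≠ 0, t ≠ 1, and s ≠ t. Then the polynomial P(X) = st(X² − 1)² + 4sX² − t(X² + 1)² in ℂ[X] has degree exactly 4 (its leading coefficient is t(s − 1) ≠ 0) and is separable, i.e. P has four distinct roots in ℂ (equivalently P and its derivative are coprime). -/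
open Polynomial

/-- A biquadratic polynomial with nonzero constant term, whose associated quadratic has nonzero
discriminant, is separable in characteristic different from two. -/
theorem separable_biquadratic {K : Type*} [Field K] (h2 : (2 : K) ≠ 0) {a b c : K} (hc : c ≠ 0)
    (hdisc : discrim a b c ≠ 0) : (C a * X ^ 4 + C b * X ^ 2 + C c : K[X]).Separable := by
  have hX : IsCoprime (C a * X ^ 4 + C b * X ^ 2 + C c : K[X]) X := by
    refine ⟨C c⁻¹, -C c⁻¹ * (C a * X ^ 3 + C b * X), ?_⟩
    have h : (C c⁻¹ * C c : K[X]) = 1 := by rw [← C_mul, inv_mul_cancel₀ hc, C_1]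
    linear_combination h
  have hq : IsCoprime (C a * X ^ 4 + C b * X ^ 2 + C c : K[X]) (C (2 * a) * X ^ 2 + C b) := by
    refine ⟨-C (discrim a b c)⁻¹ * (4 * C a),
      C (discrim a b c)⁻¹ * (C (2 * a) * X ^ 2 + C b), ?_⟩
    have h : C (discrim a b c)⁻¹ * (C b ^ 2 - 4 * C a * C c) = (1 : K[X]) := by
      have hd : (C b ^ 2 - 4 * C a * C c : K[X]) = C (discrim a b c) := by simp [discrim, C_ofNat]
      rw [hd, ← C_mul, inv_mul_cancel₀ hdisc, C_1]
    simp only [C_mul, C_ofNat]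
    linear_combination h
  have hder : derivative (C a * X ^ 4 + C b * X ^ 2 + C c : K[X]) =
      C 2 * (X * (C (2 * a) * X ^ 2 + C b)) := by
    simp [C_ofNat]
    ring
  rw [separable_def, hder]
  exact (isCoprime_mul_unit_left_right (isUnit_C.mpr h2.isUnit) _ _).mpr (hX.mul_right hq)

/-- For `s,t ∈ ℂ` with `s,t ∉ {0,1}` and `s ≠ t`, the quartic
`P = st(X²−1)² + 4sX² − t(X²+1)²` has degree exactly `4`, leading coefficient `t(s−1)`,
and is separable (four distinct roots; equivalently `P` is coprime to `P'`). -/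
theorem genus2_fibre_quartic_separable (s t : ℂ)
    (hs0 : s ≠ 0) (hs1 : s ≠ 1) (ht0 : t ≠ 0) (ht1 : t ≠ 1) (hst : s ≠ t) :
    (C (s * t) * (X ^ 2 - 1) ^ 2 + C (4 * s) * X ^ 2 - C t * (X ^ 2 + 1) ^ 2 :
        Polynomial ℂ).degree = 4 ∧
    (C (s * t) * (X ^ 2 - 1) ^ 2 + C (4 * s) * X ^ 2 - C t * (X ^ 2 + 1) ^ 2 :
        Polynomial ℂ).leadingCoeff = t * (s - 1) ∧
    (C (s * t) * (X ^ 2 - 1) ^ 2 + C (4 * s) * X ^ 2 - C t * (X ^ 2 + 1) ^ 2 :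
        Polynomial ℂ).Separable := by
  have ha : t * (s - 1) ≠ 0 := mul_ne_zero ht0 (sub_ne_zero.mpr hs1)
  have hP : (C (s * t) * (X ^ 2 - 1) ^ 2 + C (4 * s) * X ^ 2 - C t * (X ^ 2 + 1) ^ 2 : ℂ[X]) =
      C (t * (s - 1)) * X ^ 4 + C (4 * s - 2 * s * t - 2 * t) * X ^ 2 + C (t * (s - 1)) := by
    simp only [C_mul, C_sub, C_1, C_ofNat]
    ring
  have hdeg : (C (t * (s - 1)) * X ^ 4 + C (4 * s - 2 * s * t - 2 * t) * X ^ 2 +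
      C (t * (s - 1)) : ℂ[X]).degree = 4 := by
    compute_degree!
    exact ⟨ht0, sub_ne_zero.mpr hs1⟩
  rw [hP]
  refine ⟨hdeg, ?_, separable_biquadratic two_ne_zero ha ?_⟩
  · rw [leadingCoeff, natDegree_eq_of_degree_eq_some hdeg]
    simp [coeff_X_pow, -map_mul, -map_sub]
  · have h : discrim (t * (s - 1)) (4 * s - 2 * s * t - 2 * t) (t * (s - 1)) =
        16 * s * (s - t) * (1 - t) := by
      rw [discrim]
      ring
    rw [h]
    exact mul_ne_zero (mul_ne_zero (mul_ne_zero (by norm_num) hs0) (sub_ne_zero.mpr hst))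
      (sub_ne_zero.mpr ht1.symm)
end
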